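/- Let Z = {(z,λ) ∈ ℂ² : P(z,λ) = 0} for a nonconstant polynomial P ∈ ℂ[z,λ] having no factor of the form λ − c (i.e. Z has no vertical components). Suppose there exists D such that for every n ≥ 0 there is a nonzero polynomial P_n ∈ ℂ[z,λ] of total degree at most D with fⁿ(Z) ⊆ {P_n = 0}. Then Z is preperiodic under f: there exist integers 0 ≤ n < m such that the Zariski closure of f^m(Z) equals the Zariski closure of fⁿ(Z). -/

import Mathlib

open MvPolynomial

/-- The map `f : ℂ² → ℂ²`, `(z, λ) ↦ (z² + λ, λ)`. -/
noncomputable def F (p : ℂ × ℂ) : ℂ × ℂ := (p.1 ^ 2 + p.2, p.2)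

/-- Zariski closure of a subset of ℂ²: the common zero set of all polynomials
vanishing on it (variables ordered as (z, λ)). -/
def zarClosure (S : Set (ℂ × ℂ)) : Set (ℂ × ℂ) :=
  {p | ∀ P : MvPolynomial (Fin 2) ℂ,
      (∀ q ∈ S, eval ![q.1, q.2] P = 0) → eval ![p.1, p.2] P = 0}


lemma aux_grp {Γ : Type*} [LinearOrderedCommGroupWithZero Γ] {x τ : Γ} (hx : 1 < x) (hτ : 1 < τ)
    {D i k i' k' : ℕ} (hi : i ≤ D) (hk : k ≤ D) (hi' : i' ≤ D) (hk' : k' ≤ D)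
    (hne : ¬ (i = i' ∧ k = k')) (h : x ^ i * τ ^ k = x ^ i' * τ ^ k') :
    ∃ a b : ℕ, 1 ≤ a ∧ a ≤ D ∧ 1 ≤ b ∧ b ≤ D ∧ x ^ a = τ ^ b := by
  wlog hlt : i < i' generalizing i k i' k'
  · rcases lt_or_eq_of_le (not_lt.1 hlt) with h1 | h1
    · exact this hi' hk' hi hk (fun hh => hne ⟨hh.1.symm, hh.2.symm⟩) h.symm h1
    · subst h1
      have hx0 : x ^ i' ≠ 0 := pow_ne_zero _ (by rintro rfl; simp at hx)
      have h2 := mul_left_cancel₀ hx0 h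
      exact absurd ⟨rfl, (pow_right_injective₀ (zero_lt_one.trans hτ) hτ.ne') h2⟩ hne
  · have hx0 : x ^ i ≠ 0 := pow_ne_zero _ (by rintro rfl; simp at hx)
    have hτ0 : τ ≠ 0 := by rintro rfl; simp at hτ
    obtain ⟨a, rfl⟩ := Nat.exists_eq_add_of_lt hlt
    have h2 : τ ^ k = x ^ (a + 1) * τ ^ k' := by
      apply mul_left_cancel₀ hx0
      rw [h, ← mul_assoc, ← pow_add]; rfl
    have h3 : 1 < x ^ (a + 1) := one_lt_pow₀ hx (by omega)
    have h4 : k' < k := by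
      by_contra hcon
      push Not at hcon
      have : τ ^ k ≤ τ ^ k' := pow_le_pow_right₀ hτ.le hcon
      have h5 : τ ^ k' < x ^ (a + 1) * τ ^ k' := by
        have : 0 < τ ^ k' := pow_pos (zero_lt_one.trans hτ) _
        exact lt_mul_of_one_lt_left this h3
      rw [← h2] at h5
      exact absurd this (not_le.2 h5)
    obtain ⟨b, rfl⟩ := Nat.exists_eq_add_of_lt h4
    refine ⟨a + 1, b + 1, by omega, by omega, by omega, by omega, ?_⟩
    apply mul_right_cancel₀ (pow_ne_zero k' hτ0)
    rw [← h2, ← pow_add]; congr 1; omega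

lemma aux_arith {Γ : Type*} [LinearOrderedCommGroupWithZero Γ] {x τ : Γ} (hx : 1 < x)
    (D : ℕ) (h : ∀ k : ℕ, ∃ a b : ℕ, 1 ≤ a ∧ a ≤ D ∧ 1 ≤ b ∧ b ≤ D ∧ (x ^ 2 ^ k) ^ a = τ ^ b) :
    False := by
  obtain ⟨a0, b0, h1, h2, h3, h4, h5⟩ := h 0
  obtain ⟨a, b, g1, g2, g3, g4, g5⟩ := h (D * D)
  simp only [pow_zero, pow_one] at h5
  have e : x ^ (2 ^ (D * D) * a * b0) = x ^ (a0 * b) := by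
    rw [pow_mul, pow_mul, g5, pow_mul, h5, ← pow_mul, ← pow_mul, mul_comm]
  have e2 := (pow_right_injective₀ (zero_lt_one.trans hx) hx.ne') e
  have e3 : a0 * b ≤ D * D := Nat.mul_le_mul h2 g4
  have e4 : D * D < 2 ^ (D * D) := Nat.lt_two_pow_self
  have e5 : 2 ^ (D * D) ≤ 2 ^ (D * D) * a * b0 := by
    rw [mul_assoc]; exact Nat.le_mul_of_pos_right _ (Nat.mul_pos g1 h3)
  omega

section
variable {L : Type*} [Field L] [Algebra ℂ L]

lemma val_const (V : ValuationSubring L) (hV : ∀ a : ℂ, algebraMap ℂ L a ∈ V) {a : ℂ} (ha : a ≠ 0) :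
    V.valuation (algebraMap ℂ L a) = 1 := by
  apply le_antisymm ((V.valuation_le_one_iff _).2 (hV a))
  have := (V.valuation_le_one_iff _).2 (hV a⁻¹)
  rw [map_inv₀, map_inv₀] at this
  have h0 : 0 < V.valuation (algebraMap ℂ L a) := by
    rw [zero_lt_iff, Valuation.ne_zero_iff]; simpa using ha
  exact (inv_le_one₀ h0).1 this

lemma two_monomials (V : ValuationSubring L) (hV : ∀ a : ℂ, algebraMap ℂ L a ∈ V)
    (Q : MvPolynomial (Fin 2) ℂ) (hQ : Q ≠ 0) (x t : L) (hx : x ≠ 0) (ht : t ≠ 0)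
    (h : aeval ![x, t] Q = 0) :
    ∃ m ∈ Q.support, ∃ m' ∈ Q.support, m ≠ m' ∧
      V.valuation x ^ m 0 * V.valuation t ^ m 1 = V.valuation x ^ m' 0 * V.valuation t ^ m' 1 := by
  classical
  rw [aeval_def, eval₂_eq'] at h
  simp only [Fin.prod_univ_two, Matrix.cons_val_zero, Matrix.cons_val_one] at h
  have hval : ∀ m ∈ Q.support, V.valuation (algebraMap ℂ L (coeff m Q) * (x ^ m 0 * t ^ m 1)) =
      V.valuation x ^ m 0 * V.valuation t ^ m 1 := by
    intro m hm
    rw [map_mul, map_mul, map_pow, map_pow, val_const V hV (mem_support_iff.1 hm), one_mul]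
  obtain ⟨j, hj, hmax⟩ := Q.support.exists_max_image
    (fun m => V.valuation x ^ m 0 * V.valuation t ^ m 1) (by simpa using hQ)
  by_contra hcon
  push Not at hcon
  have := V.valuation.map_sum_eq_of_lt
    (f := fun m => algebraMap ℂ L (coeff m Q) * (x ^ m 0 * t ^ m 1)) hj ?_
  · rw [h, map_zero, hval j hj] at this
    have hh : V.valuation x ^ j 0 * V.valuation t ^ j 1 ≠ 0 := by simp [hx, ht]
    exact hh this.symm
  · intro i hi
    rw [Finset.mem_sdiff, Finset.mem_singleton] at hi
    show V.valuation (algebraMap ℂ L (coeff i Q) * (x ^ i 0 * t ^ i 1)) <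
      V.valuation (algebraMap ℂ L (coeff j Q) * (x ^ j 0 * t ^ j 1))
    rw [hval i hi.1, hval j hj]
    exact lt_of_le_of_ne (hmax i hi.1) (hcon i hi.1 j hj hi.2)

lemma shift_poly (Q : MvPolynomial (Fin 2) ℂ) (hQ : Q ≠ 0) (D : ℕ) (hD : Q.totalDegree ≤ D) (c : ℂ) :
    ∃ Q' : MvPolynomial (Fin 2) ℂ, Q' ≠ 0 ∧ Q'.totalDegree ≤ D ∧
      ∀ x l : L, aeval ![x, l - algebraMap ℂ L c] Q' = aeval ![x, l] Q := by
  have key : ∀ x l : L, aeval ![x, l - algebraMap ℂ L c]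
      (aeval ![X 0, X 1 + C c] Q : MvPolynomial (Fin 2) ℂ) = aeval ![x, l] Q := by
    intro x l
    rw [← AlgHom.comp_apply]
    congr 1
    apply MvPolynomial.algHom_ext
    intro i
    fin_cases i <;> simp
  have key2 : (aeval ![X 0, X 1 - C c] : _ →ₐ[ℂ] MvPolynomial (Fin 2) ℂ)
      (aeval ![X 0, X 1 + C c] Q : MvPolynomial (Fin 2) ℂ) = Q := by
    rw [← AlgHom.comp_apply]
    conv_rhs => rw [← AlgHom.id_apply (R := ℂ) Q]
    congr 1
    apply MvPolynomial.algHom_ext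
    intro i
    fin_cases i <;> simp
  refine ⟨aeval ![X 0, X 1 + C c] Q, ?_, ?_, key⟩
  · intro h
    rw [h, map_zero] at key2
    exact hQ key2.symm
  · rw [aeval_def, eval₂_eq']
    apply totalDegree_finsetSum_le
    intro m hm
    simp only [Fin.prod_univ_two, Matrix.cons_val_zero, Matrix.cons_val_one]
    have h1 := le_totalDegree hm
    rw [Finsupp.sum_fintype _ _ (by simp), Fin.sum_univ_two] at h1
    have h2 : (X 1 + C c : MvPolynomial (Fin 2) ℂ).totalDegree ≤ 1 := by
      refine (totalDegree_add _ _).trans ?_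
      simp
    calc _ ≤ _ := totalDegree_mul _ _
      _ ≤ 0 + (m 0 + m 1) := by
        gcongr
        · simp [algebraMap_eq]
        · refine (totalDegree_mul _ _).trans ?_
          gcongr
          · refine (totalDegree_pow _ _).trans ?_
            simp
          · refine (totalDegree_pow _ _).trans ?_
            nlinarith
      _ ≤ D := by omega

lemma iter_val (V : ValuationSubring L) (l x : L) (h1 : 1 < V.valuation x)
    (h2 : V.valuation l < V.valuation x ^ 2) (k : ℕ) :
    V.valuation ((fun y => y ^ 2 + l)^[k] x) = V.valuation x ^ 2 ^ k := by
  induction k with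
  | zero => simp
  | succ k ih =>
    rw [Function.iterate_succ_apply']
    have : V.valuation x ^ 2 ≤ (V.valuation x ^ 2 ^ k) ^ 2 := by
      gcongr
      exact le_self_pow₀ h1.le (by positivity)
    rw [Valuation.map_add_eq_of_lt_left, map_pow, ih, ← pow_mul, pow_succ]
    rw [map_pow, ih]
    exact lt_of_lt_of_le h2 this

/-- The key height argument. -/
lemma no_escape (V : ValuationSubring L) (hV : ∀ a : ℂ, algebraMap ℂ L a ∈ V)
    (l x : L) (c : ℂ) (hl0 : l - algebraMap ℂ L c ≠ 0)
    (hl1 : V.valuation (l - algebraMap ℂ L c) ≠ 1)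
    (h1 : 1 < V.valuation x) (h2 : V.valuation l < V.valuation x ^ 2) (D : ℕ)
    (hQ : ∀ k : ℕ, ∃ Q : MvPolynomial (Fin 2) ℂ, Q ≠ 0 ∧ Q.totalDegree ≤ D ∧
      aeval ![(fun y => y ^ 2 + l)^[k] x, l] Q = 0) : False := by
  set t := l - algebraMap ℂ L c with ht
  have hvt : V.valuation t ≠ 0 := by simpa using hl0
  have main : ∀ k : ℕ, ∃ m m' : Fin 2 →₀ ℕ, m 0 ≤ D ∧ m 1 ≤ D ∧ m' 0 ≤ D ∧ m' 1 ≤ D ∧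
      ¬ (m 0 = m' 0 ∧ m 1 = m' 1) ∧
      (V.valuation x ^ 2 ^ k) ^ m 0 * V.valuation t ^ m 1 =
        (V.valuation x ^ 2 ^ k) ^ m' 0 * V.valuation t ^ m' 1 := by
    intro k
    obtain ⟨Q, hQ0, hQD, hQe⟩ := hQ k
    obtain ⟨Q', hQ0', hQD', hQe'⟩ := shift_poly (L := L) Q hQ0 D hQD c
    have hv := iter_val V l x h1 h2 k
    have hne : (fun y => y ^ 2 + l)^[k] x ≠ 0 := by
      intro h0
      rw [h0, map_zero] at hv
      have : V.valuation x ^ 2 ^ k ≠ 0 := pow_ne_zero _ (by intro h; rw [h] at h1; simp at h1)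
      exact this hv.symm
    obtain ⟨m, hm, m', hm', hmm, he⟩ := two_monomials V hV Q' hQ0' _ t hne hl0
      ((hQe' _ l).trans hQe)
    rw [hv] at he
    have d1 := le_totalDegree hm
    have d2 := le_totalDegree hm'
    rw [Finsupp.sum_fintype _ _ (by simp), Fin.sum_univ_two] at d1 d2
    refine ⟨m, m', by omega, by omega, by omega, by omega, ?_, he⟩
    rintro ⟨e0, e1⟩
    apply hmm
    ext i
    fin_cases i <;> assumption
  have hpow : ∀ k : ℕ, 1 < V.valuation x ^ 2 ^ k := fun k => one_lt_pow₀ h1 (by positivity)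
  rcases lt_or_gt_of_ne hl1 with hlt | hgt
  · apply aux_arith (τ := (V.valuation t)⁻¹) h1 D
    intro k
    obtain ⟨m, m', d1, d2, d3, d4, hne, he⟩ := main k
    have hτ : 1 < (V.valuation t)⁻¹ := (one_lt_inv₀ (zero_lt_iff.2 hvt)).2 hlt
    refine aux_grp (hpow k) hτ d1 d4 d3 d2 (fun hh => hne ⟨hh.1, hh.2.symm⟩) ?_
    rw [inv_pow, inv_pow]
    field_simp
    rw [he, mul_comm]
  · apply aux_arith (τ := V.valuation t) h1 D
    intro k
    obtain ⟨m, m', d1, d2, d3, d4, hne, he⟩ := main k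
    exact aux_grp (hpow k) hgt d1 d2 d3 d4 hne he

lemma isIntegral_of_val {R : Type*} [CommRing R] [Algebra R L] (x : L)
    (h : ∀ V : ValuationSubring L, (∀ a : R, algebraMap R L a ∈ V) → x ∈ V) : IsIntegral R x := by
  have h1 : x ∈ (⨅ V : {V : ValuationSubring L // (Set.range (algebraMap R L)) ⊆ V.toSubring},
      V.1.toSubring) := by
    rw [Subring.mem_iInf]
    rintro ⟨V, hV⟩
    exact h V (fun a => hV ⟨a, rfl⟩)
  rw [iInf_valuationSubring_superset] at h1
  have h2 : IsIntegral (Subring.closure (Set.range (algebraMap R L))) x := h1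
  have h3 : Subring.closure (Set.range (algebraMap R L)) = (algebraMap R L).range := by
    rw [← RingHom.coe_range, Subring.closure_eq]
  rw [h3] at h2
  obtain ⟨p, hp, hpx⟩ := h2
  have hl : p ∈ Polynomial.lifts (algebraMap R L).rangeRestrict := by
    rw [Polynomial.lifts_iff_coeff_lifts]
    intro n
    exact (algebraMap R L).rangeRestrict_surjective _
  obtain ⟨q, hq, -, hqm⟩ := Polynomial.lifts_and_natDegree_eq_and_monic hl hp
  refine ⟨q, hqm, ?_⟩
  rw [← hq, Polynomial.eval₂_map] at hpx
  exact hpx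

end
section
open Polynomial
variable {K L : Type*} [Field K] [Algebra ℂ[X] K] [IsFractionRing ℂ[X] K] [Field L] [Algebra K L]
  [Algebra ℂ[X] L] [IsScalarTower ℂ[X] K L] [Algebra ℂ L] [IsScalarTower ℂ ℂ[X] L]
  [IsAlgClosed L] [Algebra.IsAlgebraic K L]

lemma poly_val (V : ValuationSubring L) (hV : ∀ a : ℂ, algebraMap ℂ L a ∈ V)
    (h : ∀ c : ℂ, 1 ≤ V.valuation (algebraMap ℂ[X] L X - algebraMap ℂ L c))
    (a : ℂ[X]) (ha : a ≠ 0) : 1 ≤ V.valuation (algebraMap ℂ[X] L a) := by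
  have hs := (IsAlgClosed.splits a).eq_prod_roots
  rw [hs, map_mul, map_mul]
  have hc : algebraMap ℂ[X] L (C a.leadingCoeff) = algebraMap ℂ L a.leadingCoeff := by
    rw [IsScalarTower.algebraMap_apply ℂ ℂ[X] L]; rfl
  rw [hc, val_const V hV (by simpa using ha), one_mul]
  generalize a.roots = r
  induction r using Multiset.induction with
  | empty => simp
  | cons c r ih =>
    rw [Multiset.map_cons, Multiset.prod_cons, map_mul, map_mul]
    have hc : algebraMap ℂ[X] L (Polynomial.X - Polynomial.C c) = algebraMap ℂ[X] L X - algebraMap ℂ L c := by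
      rw [map_sub, IsScalarTower.algebraMap_apply ℂ ℂ[X] L]; rfl
    rw [hc]
    exact one_le_mul_of_one_le_of_one_le (h c) ih

include K in
lemma l_ne (c : ℂ) : algebraMap ℂ[X] L X - algebraMap ℂ L c ≠ 0 := by
  have hinj : Function.Injective (algebraMap ℂ[X] L) := by
    rw [IsScalarTower.algebraMap_eq ℂ[X] K L]
    exact (algebraMap K L).injective.comp (IsFractionRing.injective ℂ[X] K)
  have hc : algebraMap ℂ[X] L (Polynomial.X - Polynomial.C c) = algebraMap ℂ[X] L X - algebraMap ℂ L c := by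
    rw [map_sub, IsScalarTower.algebraMap_apply ℂ ℂ[X] L]; rfl
  rw [← hc]
  intro h
  exact X_sub_C_ne_zero c (hinj (h.trans (map_zero _).symm))

include K in
lemma orb_integral (D : ℕ) (α : L)
    (hQ : ∀ k : ℕ, ∃ Q : MvPolynomial (Fin 2) ℂ, Q ≠ 0 ∧ Q.totalDegree ≤ D ∧
      MvPolynomial.aeval ![(fun y => y ^ 2 + algebraMap ℂ[X] L X)^[k] α, algebraMap ℂ[X] L X] Q = 0) :
    IsIntegral ℂ[X] α := by
  apply isIntegral_of_val
  intro V hV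
  have hVC : ∀ a : ℂ, algebraMap ℂ L a ∈ V := by
    intro a
    rw [IsScalarTower.algebraMap_apply ℂ ℂ[X] L]
    exact hV _
  by_contra hα
  have h1 : 1 < V.valuation α := by
    rw [← not_le, V.valuation_le_one_iff]; exact hα
  have hl : V.valuation (algebraMap ℂ[X] L X) ≤ 1 := (V.valuation_le_one_iff _).2 (hV _)
  by_cases hc : ∀ c : ℂ, 1 ≤ V.valuation (algebraMap ℂ[X] L X - algebraMap ℂ L c)
  · have hp := poly_val V hVC hc
    have hK : ∀ x : K, algebraMap K L x ∈ V := by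
      intro x
      obtain ⟨a, b, hb, rfl⟩ := IsFractionRing.div_surjective (A := ℂ[X]) x
      rw [map_div₀, ← IsScalarTower.algebraMap_apply, ← IsScalarTower.algebraMap_apply,
        div_eq_mul_inv]
      apply V.mul_mem _ _ (hV a)
      rw [← V.valuation_le_one_iff, map_inv₀]
      exact inv_le_one_of_one_le₀ (hp b (nonZeroDivisors.ne_zero hb))
    obtain ⟨p, hpm, hpe⟩ := (Algebra.IsAlgebraic.isAlgebraic (R := K) α).isIntegral
    have hi : IsIntegral V α := by
      refine ⟨p.map ((algebraMap K L).codRestrict V.toSubring hK), hpm.map _, ?_⟩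
      rw [Polynomial.eval₂_map]
      exact hpe
    obtain ⟨y, hy⟩ := IsIntegrallyClosed.isIntegral_iff.1 hi
    exact hα (hy ▸ y.2)
  · push Not at hc
    obtain ⟨c, hc⟩ := hc
    exact no_escape V hVC _ α c (l_ne (K := K) c) hc.ne h1
      (lt_of_le_of_lt hl (one_lt_pow₀ h1 two_ne_zero)) D hQ

include K in
lemma exists_inf : ∃ V : ValuationSubring L, (∀ a : ℂ, algebraMap ℂ L a ∈ V) ∧
    1 < V.valuation (algebraMap ℂ[X] L X) := by
  by_contra hcon
  push Not at hcon
  have h1 : IsIntegral ℂ (algebraMap ℂ[X] L X) := by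
    apply isIntegral_of_val
    intro V hV
    exact (V.valuation_le_one_iff _).1 (hcon V hV)
  have hinj : Function.Injective (algebraMap ℂ[X] L) := by
    rw [IsScalarTower.algebraMap_eq ℂ[X] K L]
    exact (algebraMap K L).injective.comp (IsFractionRing.injective ℂ[X] K)
  have h2 : IsIntegral ℂ (X : ℂ[X]) := (isIntegral_algebraMap_iff hinj).1 h1
  exact transcendental_X ℂ h2.isAlgebraic

lemma inf_linear (V : ValuationSubring L) (hV : ∀ a : ℂ, algebraMap ℂ L a ∈ V)
    (hl : 1 < V.valuation (algebraMap ℂ[X] L X)) (c : ℂ) :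
    1 ≤ V.valuation (algebraMap ℂ[X] L X - algebraMap ℂ L c) := by
  rw [Valuation.map_sub_eq_of_lt_left]
  · exact hl.le
  · exact lt_of_le_of_lt ((V.valuation_le_one_iff _).2 (hV c)) hl

lemma val_two (V : ValuationSubring L) (hV : ∀ a : ℂ, algebraMap ℂ L a ∈ V) (s : L) :
    V.valuation (2 * s) = V.valuation s := by
  have := val_const V hV (two_ne_zero (α := ℂ))
  rw [map_ofNat] at this
  rw [map_mul, this, one_mul]

lemma sign_lemma (V : ValuationSubring L) (hV : ∀ a : ℂ, algebraMap ℂ L a ∈ V) (l s x : L)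
    (hs : s ^ 2 = - l) (hl : 1 < V.valuation l) (hx : V.valuation (x ^ 2 + l) ^ 2 ≤ V.valuation l) :
    V.valuation (x - s) ≤ 1 ∨ V.valuation (x + s) ≤ 1 := by
  have hvs : V.valuation s ^ 2 = V.valuation l := by rw [← map_pow, hs, Valuation.map_neg]
  rw [← hvs] at hx
  have hx' : V.valuation (x ^ 2 + l) ≤ V.valuation s := le_of_pow_le_pow_left₀ two_ne_zero zero_le hx
  have hs1 : 1 < V.valuation s := by
    by_contra h
    push Not at h
    rw [← hvs] at hl
    exact absurd (pow_le_one₀ zero_le h) (not_le.2 hl)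
  have hprod : V.valuation (x - s) * V.valuation (x + s) ≤ V.valuation s := by
    rw [← map_mul]
    convert hx' using 2
    linear_combination -hs
  have h2s : V.valuation s ≤ max (V.valuation (x + s)) (V.valuation (x - s)) := by
    rw [← val_two V hV s]
    convert V.valuation.map_sub (x + s) (x - s) using 2
    ring
  have hs0 : 0 < V.valuation s := zero_lt_one.trans hs1
  by_contra hcon
  push Not at hcon
  rcases le_max_iff.1 h2s with h | h
  · have : V.valuation s < V.valuation (x - s) * V.valuation (x + s) :=
      lt_of_lt_of_le (lt_mul_of_one_lt_left hs0 hcon.1) (by gcongr)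
    exact absurd hprod (not_le.2 this)
  · have : V.valuation s < V.valuation (x - s) * V.valuation (x + s) :=
      lt_of_lt_of_le (lt_mul_of_one_lt_right hs0 hcon.2) (by gcongr)
    exact absurd hprod (not_le.2 this)

lemma close1 (V : ValuationSubring L) (ε x y : L) 
    (hx : V.valuation (x - ε) ≤ 1) (hy : V.valuation (y - ε) ≤ 1) : V.valuation (x - y) ≤ 1 := by
  have : x - y = (x - ε) - (y - ε) := by ring
  rw [this]
  exact V.valuation.map_sub_le hx hy

lemma close2 (V : ValuationSubring L) (hV : ∀ a : ℂ, algebraMap ℂ L a ∈ V) (l ε x y : L)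
    (hs : ε ^ 2 = - l) (hl : 1 < V.valuation l)
    (hx : V.valuation (x - ε) ≤ 1) (hy : V.valuation (y - ε) ≤ 1)
    (h : V.valuation ((x ^ 2 + l) - (y ^ 2 + l)) ≤ 1) : V.valuation (x - y) < 1 := by
  have hvs : V.valuation ε ^ 2 = V.valuation l := by rw [← map_pow, hs, Valuation.map_neg]
  have hs1 : 1 < V.valuation ε := by
    by_contra h
    push Not at h
    rw [← hvs] at hl
    exact absurd (pow_le_one₀ zero_le h) (not_le.2 hl)
  have h1 : V.valuation (x + y) = V.valuation ε := by
    have : x + y = 2 * ε + ((x - ε) + (y - ε)) := by ring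
    rw [this, Valuation.map_add_eq_of_lt_left, val_two V hV]
    rw [val_two V hV]
    exact lt_of_le_of_lt (V.valuation.map_add_le hx hy) hs1
  have h2 : (x ^ 2 + l) - (y ^ 2 + l) = (x - y) * (x + y) := by ring
  rw [h2, map_mul, h1] at h
  by_contra hcon
  push Not at hcon
  have : V.valuation ε ≤ V.valuation (x - y) * V.valuation ε := by
    exact le_mul_of_one_le_left zero_le hcon
  exact absurd (this.trans h) (not_le.2 hs1)

lemma zero_of_conj (V : ValuationSubring L) (hV : ∀ a : ℂ, algebraMap ℂ L a ∈ V)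
    (hl : 1 < V.valuation (algebraMap ℂ[X] L X)) (x : L) (hx : IsIntegral ℂ[X] x)
    (hc : ∀ σ : L ≃ₐ[K] L, V.valuation (σ x) < 1) : x = 0 := by
  classical
  have : Normal K L := by
    have : IsAlgClosure K L := ⟨inferInstance, inferInstance⟩
    exact IsAlgClosure.normal K L
  have hxK : IsIntegral K x := hx.tower_top
  have hmin := minpoly.isIntegrallyClosed_eq_field_fractions' K hx
  set μ := (minpoly K x).map (algebraMap K L) with hμ
  have hmon : μ.Monic := (minpoly.monic hxK).map _
  have hroot : ∀ y ∈ μ.roots, V.valuation y < 1 := by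
    intro y hy
    have hy' : aeval y (minpoly K x) = 0 := by
      rw [mem_roots hmon.ne_zero, hμ, IsRoot.def, eval_map_algebraMap] at hy
      exact hy
    obtain ⟨σ, hσ⟩ := (isConjRoot_of_aeval_eq_zero hxK hy').symm.exists_algEquiv
    rw [← hσ]
    exact hc σ
  have hxr : x ∈ μ.roots := by
    rw [mem_roots hmon.ne_zero, hμ, IsRoot.def, eval_map_algebraMap]
    exact minpoly.aeval K x
  have h0 := (IsAlgClosed.splits μ).coeff_zero_eq_prod_roots_of_monic hmon
  obtain ⟨r, hr⟩ := Multiset.exists_cons_of_mem hxr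
  have hlt : V.valuation (μ.coeff 0) < 1 := by
    rw [h0, hr, Multiset.prod_cons, map_mul, map_mul, map_pow, Valuation.map_neg, map_one, one_pow,
      one_mul]
    have hrp : r.prod ∈ V := by
      apply multiset_prod_mem
      intro y hy
      rw [← V.valuation_le_one_iff]
      exact (hroot y (by rw [hr]; exact Multiset.mem_cons_of_mem hy)).le
    rw [← V.valuation_le_one_iff] at hrp
    exact lt_of_le_of_lt (mul_le_of_le_one_right zero_le hrp) (hroot x hxr)
  have hcoef : μ.coeff 0 = algebraMap ℂ[X] L ((minpoly ℂ[X] x).coeff 0) := by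
    rw [hμ, hmin, Polynomial.coeff_map, Polynomial.coeff_map, ← IsScalarTower.algebraMap_apply]
  rw [hcoef] at hlt
  have hz : (minpoly ℂ[X] x).coeff 0 = 0 := by
    by_contra hne
    exact absurd (poly_val V hV (inf_linear V hV hl) _ hne) (not_le.2 hlt)
  have hz' : (minpoly K x).coeff 0 = 0 := by rw [hmin, Polynomial.coeff_map, hz, map_zero]
  exact (minpoly.coeff_zero_eq_zero hxK).1 hz'

lemma g_equiv (σ : L ≃ₐ[K] L) (n : ℕ) (α : L) :
    σ ((fun y => y ^ 2 + algebraMap ℂ[X] L X)^[n] α) =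
      (fun y => y ^ 2 + algebraMap ℂ[X] L X)^[n] (σ α) := by
  induction n with
  | zero => rfl
  | succ n ih =>
    rw [Function.iterate_succ_apply', Function.iterate_succ_apply', map_add, map_pow, ih,
      IsScalarTower.algebraMap_apply ℂ[X] K L, σ.commutes]

lemma g_integral (n : ℕ) (α : L) (h : IsIntegral ℂ[X] α) :
    IsIntegral ℂ[X] ((fun y => y ^ 2 + algebraMap ℂ[X] L X)^[n] α) := by
  induction n with
  | zero => exact h
  | succ n ih =>
    rw [Function.iterate_succ_apply']
    exact (ih.pow 2).add isIntegral_algebraMap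

lemma preper (S : Finset L) (hS : ∀ σ : L ≃ₐ[K] L, ∀ α ∈ S, σ α ∈ S) (D : ℕ)
    (hQ : ∀ α ∈ S, ∀ k : ℕ, ∃ Q : MvPolynomial (Fin 2) ℂ, Q ≠ 0 ∧ Q.totalDegree ≤ D ∧
      MvPolynomial.aeval ![(fun y => y ^ 2 + algebraMap ℂ[X] L X)^[k] α, algebraMap ℂ[X] L X] Q = 0) :
    ∃ n m : ℕ, n < m ∧ ∀ α ∈ S, (fun y => y ^ 2 + algebraMap ℂ[X] L X)^[m] α =
      (fun y => y ^ 2 + algebraMap ℂ[X] L X)^[n] α := by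
  classical
  obtain ⟨V, hV, hl⟩ := exists_inf (K := K) (L := L)
  set l := algebraMap ℂ[X] L X with hldef
  set g : L → L := fun y => y ^ 2 + l with hg
  have hbd : ∀ α ∈ S, ∀ n, V.valuation (g^[n] α) ^ 2 ≤ V.valuation l := by
    intro α hα n
    by_contra hcon
    push Not at hcon
    have h1 : 1 < V.valuation (g^[n] α) := by
      by_contra h
      push Not at h
      exact absurd (pow_le_one₀ zero_le h) (not_le.2 (hl.trans hcon))
    refine no_escape V hV l (g^[n] α) 0 (l_ne (K := K) 0) ?_ h1 hcon D ?_
    · rw [map_zero, sub_zero]; exact hl.ne'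
    · intro k
      obtain ⟨Q, h1, h2, h3⟩ := hQ α hα (k + n)
      refine ⟨Q, h1, h2, ?_⟩
      rw [← Function.iterate_add_apply]
      exact h3
  obtain ⟨s, hs⟩ := IsAlgClosed.exists_pow_nat_eq (-l) (n := 2) two_pos
  have hs' : (-s) ^ 2 = - l := by rw [neg_sq, hs]
  let sg : L → ℕ → Bool := fun α n => decide (V.valuation (g^[n] α - s) ≤ 1)
  let e : Bool → L := fun b => if b then s else -s
  have he : ∀ b, e b ^ 2 = -l := by intro b; cases b <;> simp [e, hs]
  have hsg : ∀ α ∈ S, ∀ n, V.valuation (g^[n] α - e (sg α n)) ≤ 1 := by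
    intro α hα n
    by_cases h : V.valuation (g^[n] α - s) ≤ 1
    · have hb : sg α n = true := decide_eq_true h
      rw [hb]
      exact h
    · have h2 := hbd α hα (n + 1)
      rw [Function.iterate_succ_apply'] at h2
      have := (sign_lemma V hV l s (g^[n] α) hs hl h2).resolve_left h
      have hb : sg α n = false := decide_eq_false h
      rw [hb]
      show V.valuation (g^[n] α - (if false = true then s else -s)) ≤ 1
      rw [if_neg (by simp), sub_neg_eq_add]
      exact this
  obtain ⟨n, m, hnm, heq⟩ := Finite.exists_ne_map_eq_of_infinite
    (fun n : ℕ => fun α : S => (sg α n, sg α (n + 1)))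
  have main : ∀ α ∈ S, g^[m] α = g^[n] α := by
    have hlt : ∀ α ∈ S, V.valuation (g^[m] α - g^[n] α) < 1 := by
      intro α hα
      have h := congrFun heq ⟨α, hα⟩
      simp only [Prod.mk.injEq] at h
      refine close2 V hV l (e (sg α m)) _ _ (he _) hl (hsg α hα m) (h.1 ▸ hsg α hα n) ?_
      have h1 := hsg α hα (m + 1)
      have h2 := hsg α hα (n + 1)
      rw [h.2] at h2
      have h3 := close1 V _ _ _ h1 h2
      rw [Function.iterate_succ_apply', Function.iterate_succ_apply'] at h3
      exact h3
    intro α hα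
    rw [← sub_eq_zero]
    have hint := orb_integral (K := K) D α (hQ α hα)
    refine zero_of_conj (K := K) V hV hl _ ((g_integral m α hint).sub (g_integral n α hint)) ?_
    intro σ
    have e1 := g_equiv (K := K) σ m α
    have e2 := g_equiv (K := K) σ n α
    rw [map_sub, e1, e2]
    exact hlt _ (hS σ α hα)
  rcases lt_or_gt_of_ne hnm with h | h
  · exact ⟨n, m, h, main⟩
  · exact ⟨m, n, h, fun α hα => (main α hα).symm⟩

end

section
open Polynomial

/-- `z` is the outer variable, `λ` the inner one. -/
noncomputable def phiHom : MvPolynomial (Fin 2) ℂ →ₐ[ℂ] ℂ[X][X] :=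
  MvPolynomial.aeval ![Polynomial.X, Polynomial.C Polynomial.X]

noncomputable def psiHom : ℂ[X][X] →+* MvPolynomial (Fin 2) ℂ :=
  Polynomial.eval₂RingHom
    (Polynomial.aeval (MvPolynomial.X 1 : MvPolynomial (Fin 2) ℂ)).toRingHom (MvPolynomial.X 0)

lemma psi_phi (Q : MvPolynomial (Fin 2) ℂ) : psiHom (phiHom Q) = Q := by
  have : (psiHom.comp phiHom.toRingHom) = RingHom.id _ := by
    apply MvPolynomial.ringHom_ext
    · intro r
      simp [psiHom, phiHom, MvPolynomial.algebraMap_eq]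
    · intro i
      fin_cases i <;> simp [psiHom, phiHom]
  exact congrArg (fun f => f Q) this

lemma phi_ne {Q : MvPolynomial (Fin 2) ℂ} (h : Q ≠ 0) : phiHom Q ≠ 0 := by
  intro h0
  apply h
  rw [← psi_phi Q, h0, map_zero]

lemma phi_primitive (P : MvPolynomial (Fin 2) ℂ) (hP : P ≠ 0)
    (hvert : ¬ ∃ c : ℂ, (MvPolynomial.X 1 - MvPolynomial.C c : MvPolynomial (Fin 2) ℂ) ∣ P) :
    (phiHom P).IsPrimitive := by
  intro a ha
  by_contra hu
  have ha0 : a ≠ 0 := by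
    rintro rfl
    rw [map_zero, zero_dvd_iff] at ha
    exact phi_ne hP ha
  have hdeg : a.degree ≠ 0 := fun h => hu (Polynomial.isUnit_iff_degree_eq_zero.2 h)
  obtain ⟨c, hc⟩ := IsAlgClosed.exists_root a hdeg
  apply hvert
  refine ⟨c, ?_⟩
  have h1 : Polynomial.C (Polynomial.X - Polynomial.C c) ∣ phiHom P :=
    (_root_.map_dvd Polynomial.C (Polynomial.dvd_iff_isRoot.2 hc)).trans ha
  have h2 := _root_.map_dvd psiHom h1
  rw [psi_phi] at h2
  simpa [psiHom, MvPolynomial.algebraMap_eq] using h2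

variable {L : Type*} [Field L] [Algebra ℂ[X] L] [Algebra ℂ L] [IsScalarTower ℂ ℂ[X] L]

lemma phi_aeval (Q : MvPolynomial (Fin 2) ℂ) (x : L) :
    Polynomial.aeval x (phiHom Q) = MvPolynomial.aeval ![x, algebraMap ℂ[X] L Polynomial.X] Q := by
  have : ((Polynomial.aeval x : ℂ[X][X] →ₐ[ℂ[X]] L).restrictScalars ℂ).comp phiHom =
      MvPolynomial.aeval ![x, algebraMap ℂ[X] L Polynomial.X] := by
    apply MvPolynomial.algHom_ext
    intro i
    fin_cases i <;> simp [phiHom]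
  exact congrArg (fun f => f Q) this

/-- The polynomial of the `n`-th iterate. -/
noncomputable def itPoly (n : ℕ) : MvPolynomial (Fin 2) ℂ :=
  (fun q => q ^ 2 + MvPolynomial.X 1)^[n] (MvPolynomial.X 0)

lemma itPoly_aeval {B : Type*} [CommRing B] [Algebra ℂ B] (x l : B) (n : ℕ) :
    MvPolynomial.aeval ![x, l] (itPoly n) = (fun y => y ^ 2 + l)^[n] x := by
  induction n with
  | zero => simp [itPoly]
  | succ n ih =>
    have : itPoly (n + 1) = itPoly n ^ 2 + MvPolynomial.X 1 := by
      simp only [itPoly, Function.iterate_succ_apply']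
    rw [this, Function.iterate_succ_apply', map_add, map_pow, ih]
    simp

lemma F_iter (n : ℕ) (p : ℂ × ℂ) : F^[n] p = ((fun y => y ^ 2 + p.2)^[n] p.1, p.2) := by
  induction n with
  | zero => rfl
  | succ n ih => rw [Function.iterate_succ_apply', Function.iterate_succ_apply', ih]; rfl

lemma nullst (P Q : MvPolynomial (Fin 2) ℂ)
    (h : ∀ p : ℂ × ℂ, MvPolynomial.eval ![p.1, p.2] P = 0 → MvPolynomial.eval ![p.1, p.2] Q = 0)
    {B : Type*} [Field B] [Algebra ℂ B] (v : Fin 2 → B) (hv : MvPolynomial.aeval v P = 0) :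
    MvPolynomial.aeval v Q = 0 := by
  have h1 : Q ∈ MvPolynomial.vanishingIdeal ℂ (MvPolynomial.zeroLocus ℂ (Ideal.span {P})) := by
    rw [MvPolynomial.mem_vanishingIdeal_iff]
    intro x hx
    have hx' := hx P (Ideal.subset_span rfl)
    have e : x = ![x 0, x 1] := by ext i; fin_cases i <;> rfl
    rw [e] at hx' ⊢
    exact h (x 0, x 1) hx'
  rw [MvPolynomial.vanishingIdeal_zeroLocus_eq_radical] at h1
  obtain ⟨k, hk⟩ := h1
  obtain ⟨R, hR⟩ := Ideal.mem_span_singleton.1 hk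
  have := congrArg (MvPolynomial.aeval v) hR
  rw [map_mul, hv, zero_mul, map_pow] at this
  exact eq_zero_of_pow_eq_zero this

lemma back (K : Type*) [Field K] [Algebra ℂ[X] K] [IsFractionRing ℂ[X] K] [Algebra K L]
    [IsScalarTower ℂ[X] K L] [IsAlgClosed L] (p h : ℂ[X][X]) (hp : p.IsPrimitive)
    (hroot : ∀ α : L, Polynomial.aeval α p = 0 → Polynomial.aeval α h = 0) :
    ∃ N : ℕ, p ∣ h ^ N := by
  have hinj : Function.Injective (algebraMap ℂ[X] L) := by
    rw [IsScalarTower.algebraMap_eq ℂ[X] K L]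
    exact (algebraMap K L).injective.comp (IsFractionRing.injective ℂ[X] K)
  set pL := p.map (algebraMap ℂ[X] L) with hpL
  have hp0 : pL ≠ 0 := (Polynomial.map_ne_zero_iff hinj).2 hp.ne_zero
  refine ⟨pL.roots.card, ?_⟩
  apply hp.dvd_of_fraction_map_dvd_fraction_map (K := K)
  rw [← Polynomial.map_dvd_map' (algebraMap K L), Polynomial.map_map, Polynomial.map_map,
    ← IsScalarTower.algebraMap_eq, ← hpL, Polynomial.map_pow]
  rw [(IsAlgClosed.splits pL).eq_prod_roots]
  have hlead : IsUnit (Polynomial.C pL.leadingCoeff) :=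
    Polynomial.isUnit_C.2 (IsUnit.mk0 _ (by simpa using hp0))
  rw [hlead.mul_left_dvd]
  have hr : ∀ α ∈ pL.roots, (Polynomial.X - Polynomial.C α) ∣ h.map (algebraMap ℂ[X] L) := by
    intro α hα
    rw [Polynomial.dvd_iff_isRoot, Polynomial.IsRoot.def, Polynomial.eval_map_algebraMap]
    apply hroot
    rw [Polynomial.mem_roots hp0, Polynomial.IsRoot.def, hpL, Polynomial.eval_map_algebraMap] at hα
    exact hα
  have hcard : (Polynomial.C pL.leadingCoeff * (Multiset.map (fun a => Polynomial.X - Polynomial.C a)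
    pL.roots).prod).roots.card = pL.roots.card := by
      rw [← (IsAlgClosed.splits pL).eq_prod_roots]
  rw [hcard]
  generalize pL.roots = r at hr
  induction r using Multiset.induction with
  | empty => simp
  | cons c r ih =>
    rw [Multiset.map_cons, Multiset.prod_cons, Multiset.card_cons, pow_succ']
    exact mul_dvd_mul (hr c (Multiset.mem_cons_self _ _))
      (ih fun a ha => hr a (Multiset.mem_cons_of_mem ha))
end

/- Variables of `P` are ordered as (z, λ): index 0 is z, index 1 is λ. -/
theorem stmt11 (P : MvPolynomial (Fin 2) ℂ) (hP : 0 < P.totalDegree)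
    (hvert : ¬ ∃ c : ℂ, (X 1 - C c : MvPolynomial (Fin 2) ℂ) ∣ P)
    (Z : Set (ℂ × ℂ)) (hZ : Z = {p | eval ![p.1, p.2] P = 0})
    (D : ℕ)
    (hdeg : ∀ n : ℕ, ∃ Pn : MvPolynomial (Fin 2) ℂ, Pn ≠ 0 ∧ Pn.totalDegree ≤ D ∧
      F^[n] '' Z ⊆ {p | eval ![p.1, p.2] Pn = 0}) :
    ∃ n m : ℕ, n < m ∧ zarClosure (F^[m] '' Z) = zarClosure (F^[n] '' Z) := by
  classical
  let K := FractionRing (Polynomial ℂ)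
  let L := AlgebraicClosure K
  have hP0 : P ≠ 0 := by rintro rfl; simp at hP
  have hinj : Function.Injective (algebraMap (Polynomial ℂ) L) := by
    rw [IsScalarTower.algebraMap_eq (Polynomial ℂ) K L]
    exact (algebraMap K L).injective.comp (IsFractionRing.injective (Polynomial ℂ) K)
  set p := phiHom P with hp
  have hpp : p.IsPrimitive := phi_primitive P hP0 hvert
  have hp0 : p.map (algebraMap (Polynomial ℂ) L) ≠ 0 :=
    (Polynomial.map_ne_zero_iff hinj).2 (phi_ne hP0)
  let S : Finset L := (p.map (algebraMap (Polynomial ℂ) L)).roots.toFinset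
  have hS : ∀ α : L, α ∈ S ↔ Polynomial.aeval α p = 0 := by
    intro α
    rw [Multiset.mem_toFinset, Polynomial.mem_roots hp0, Polynomial.IsRoot.def,
      Polynomial.eval_map_algebraMap]
  obtain ⟨n, m, hnm, hmain⟩ := preper (K := K) (L := L) S (by
    intro σ α hα
    rw [hS] at hα ⊢
    have := congrArg σ hα
    rw [map_zero] at this
    rw [← this]
    exact Polynomial.aeval_algHom_apply (σ.toAlgHom.restrictScalars (Polynomial ℂ)) α p) D (by
    intro α hα k
    obtain ⟨Q, h1, h2, h3⟩ := hdeg k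
    refine ⟨Q, h1, h2, ?_⟩
    rw [hS, hp, phi_aeval] at hα
    have h4 := nullst P (aeval ![itPoly k, X 1] Q) (by
      intro q hq
      have h5 := h3 ⟨q, by rw [hZ]; exact hq, rfl⟩
      rw [F_iter] at h5
      have h6 : aeval ![q.1, q.2] (aeval ![itPoly k, X 1] Q : MvPolynomial (Fin 2) ℂ) =
          aeval ![(fun y => y ^ 2 + q.2)^[k] q.1, q.2] Q := by
        rw [← AlgHom.comp_apply]
        congr 1
        apply MvPolynomial.algHom_ext
        intro i
        fin_cases i
        · simpa using itPoly_aeval q.1 q.2 k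
        · simp
      exact h6.trans h5) _ hα
    rw [← AlgHom.comp_apply] at h4
    rw [← h4]
    congr 1
    apply MvPolynomial.algHom_ext
    intro i
    fin_cases i
    · simpa using (itPoly_aeval α (algebraMap (Polynomial ℂ) L Polynomial.X) k).symm
    · simp)
  refine ⟨n, m, hnm, ?_⟩
  obtain ⟨N, hN⟩ := back (L := L) K p (phiHom (itPoly m - itPoly n)) hpp (by
    intro α hα
    rw [phi_aeval, map_sub, itPoly_aeval, itPoly_aeval, sub_eq_zero]
    exact hmain α ((hS α).2 hα))
  have hN2 := _root_.map_dvd psiHom hN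
  rw [hp, map_pow, psi_phi, psi_phi] at hN2
  have hpt : ∀ q ∈ Z, F^[m] q = F^[n] q := by
    intro q hq
    rw [hZ] at hq
    obtain ⟨R, hR⟩ := hN2
    have h1 := congrArg (aeval ![q.1, q.2]) hR
    have hq' : aeval ![q.1, q.2] P = 0 := hq
    rw [map_mul, hq', zero_mul, map_pow] at h1
    have h2 := eq_zero_of_pow_eq_zero h1
    rw [map_sub, itPoly_aeval, itPoly_aeval, sub_eq_zero] at h2
    rw [F_iter, F_iter, h2]
  rw [Set.image_congr hpt]
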